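/- For all n ∈ ℕ and all s ∈ ℕ with s ≥ 1, the following identity holds in ℤ[q]: q^{s(s−1)/2} binom_q(n,s) = Σ_{j=1}^{s} (−1)^{j−1} q^{(s−j)(s−j−1)/2} binom_q(n,j) binom_q(n−j, s−j). -/

import Mathlib

open Finset

noncomputable section

/-- The base field `ℚ(q)` of rational functions over `ℚ`. -/
abbrev K : Type := RatFunc ℚ

/-- The indeterminate `q`. -/
def q : K := RatFunc.X

/-- The `x`-number `(n)_x = (x^n - 1)/(x - 1)`. -/
def qn (x : K) (n : ℕ) : K := (x ^ n - 1) / (x - 1)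

/-- The `x`-factorial `(n)_x!`. -/
def qnFact (x : K) (n : ℕ) : K := ∏ r ∈ Finset.Icc 1 n, qn x r

/-- The `x`-binomial coefficient `binom_x(n,s)`, zero when `s > n`. -/
def qBinom (x : K) (n s : ℕ) : K :=
  if s ≤ n then qnFact x n / (qnFact x s * qnFact x (n - s)) else 0

/-- The balanced `q`-integer `[n]_q = (q^n - q^{-n})/(q - q^{-1})`. -/
def qint (n : ℕ) : K := (q ^ n - q⁻¹ ^ n) / (q - q⁻¹)

/-- The balanced `q`-factorial `[n]_q!`. -/
def qintFact (n : ℕ) : K := ∏ r ∈ Finset.Icc 1 n, qint r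

variable {A : Type*} [Ring A] [Algebra K A]

/-- The `q`-divided power `X^{(n)} = X^n / [n]_q!`. -/
def dp (X : A) (n : ℕ) : A := (qintFact n)⁻¹ • X ^ n

/-- The `q`-binomial coefficient `C_q(X; c, n) = ∏_{s=1}^n (q^{c+1-s} X - 1)/(q^s - 1)`. -/
def Cq (X : A) (c : ℤ) : ℕ → A
  | 0 => 1
  | n + 1 => (q ^ ((n : ℤ) + 1) - 1)⁻¹ • (Cq X c n * (q ^ (c - (n : ℤ)) • X - 1))

/-- The bracket `{X; c | n, r} = Σ_{s=0}^r q^{s(s+1)/2} binom_q(r,s) C_q(X; c+s, n-r)`. -/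
def Sq (X : A) (c : ℤ) (n r : ℕ) : A :=
  ∑ s ∈ Finset.range (r + 1),
    (q ^ (s * (s + 1) / 2) * qBinom q r s) • Cq X (c + (s : ℤ)) (n - r)

end

theorem q_pow_ne_one {n : ℕ} (hn : n ≠ 0) : q ^ n ≠ 1 := by
  intro h
  have h2 : algebraMap (Polynomial ℚ) (RatFunc ℚ) (Polynomial.X ^ n) =
      algebraMap (Polynomial ℚ) (RatFunc ℚ) 1 := by
    rw [map_pow, RatFunc.algebraMap_X, map_one]
    exact h
  have h3 := congrArg Polynomial.natDegree (RatFunc.algebraMap_injective ℚ h2)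
  rw [Polynomial.natDegree_X_pow, Polynomial.natDegree_one] at h3
  exact hn h3

theorem q_sub_one_ne_zero : q - 1 ≠ 0 := by
  have h := q_pow_ne_one one_ne_zero
  rw [pow_one] at h
  exact sub_ne_zero.mpr h

theorem qn_q_ne_zero {n : ℕ} (hn : n ≠ 0) : qn q n ≠ 0 :=
  div_ne_zero (sub_ne_zero.mpr (q_pow_ne_one hn)) q_sub_one_ne_zero

theorem qn_add (x : K) (a b : ℕ) : qn x (a + b) = x ^ b * qn x a + qn x b := by
  unfold qn
  rw [← mul_div_assoc, ← add_div]
  ring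

@[simp] theorem qnFact_zero (x : K) : qnFact x 0 = 1 := by simp [qnFact]

theorem qnFact_succ (x : K) (n : ℕ) : qnFact x (n + 1) = qnFact x n * qn x (n + 1) :=
  Finset.prod_Icc_succ_top (by omega) _

theorem qnFact_q_ne_zero (n : ℕ) : qnFact q n ≠ 0 :=
  Finset.prod_ne_zero_iff.mpr fun r hr => qn_q_ne_zero (by have := Finset.mem_Icc.mp hr; omega)

theorem qBinom_add (x : K) (a b : ℕ) :
    qBinom x (a + b) a = qnFact x (a + b) / (qnFact x a * qnFact x b) := by
  simp [qBinom]

theorem qBinom_of_lt (x : K) {n s : ℕ} (h : n < s) : qBinom x n s = 0 := by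
  simp [qBinom, h]

theorem qBinom_zero_right (n : ℕ) : qBinom q n 0 = 1 := by
  simp [qBinom, qnFact_q_ne_zero]

theorem qBinom_self (n : ℕ) : qBinom q n n = 1 := by
  simp [qBinom, qnFact_q_ne_zero]

/-- The `q`-Pascal rule. -/
theorem qBinom_pascal (a b : ℕ) :
    qBinom q (a + b + 1) (a + 1) = q ^ b * qBinom q (a + b) a + qBinom q (a + b) (a + 1) := by
  rcases b with _ | b
  · simp [qBinom_self, qBinom_of_lt]
  · have h1 : qBinom q (a + (b + 1) + 1) (a + 1) =
        qnFact q (a + b + 2) / (qnFact q (a + 1) * qnFact q (b + 1)) := by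
      rw [show a + (b + 1) + 1 = (a + 1) + (b + 1) by ring, qBinom_add]
      congr 2
      ring
    have h2 : qBinom q (a + (b + 1)) (a + 1) =
        qnFact q (a + b + 1) / (qnFact q (a + 1) * qnFact q b) := by
      rw [show a + (b + 1) = (a + 1) + b by ring, qBinom_add]
      congr 2
      ring
    have h3 : qn q (a + b + 2) = q ^ (b + 1) * qn q (a + 1) + qn q (b + 1) := by
      rw [← qn_add]
      congr 1
      ring
    rw [h1, h2, qBinom_add, ← add_assoc a b 1, qnFact_succ q (a + b + 1), h3,
      qnFact_succ q a, qnFact_succ q b]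
    have ha := qnFact_q_ne_zero a
    have hb := qnFact_q_ne_zero b
    have ha' : qn q (a + 1) ≠ 0 := qn_q_ne_zero (by omega)
    have hb' : qn q (b + 1) ≠ 0 := qn_q_ne_zero (by omega)
    field_simp

theorem qBinom_mul_qBinom_sub {n s j : ℕ} (hj : j ≤ s) :
    qBinom q n j * qBinom q (n - j) (s - j) = qBinom q n s * qBinom q s j := by
  obtain ⟨k, rfl⟩ := Nat.exists_eq_add_of_le hj
  rcases le_or_gt (j + k) n with h | h
  · obtain ⟨l, rfl⟩ := Nat.exists_eq_add_of_le h
    have h1 : j + k + l - j = k + l := by omega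
    have h2 : j + k - j = k := by omega
    rw [h1, h2, qBinom_add, qBinom_add, qBinom_add, add_assoc j k l, qBinom_add]
    have hj := qnFact_q_ne_zero j
    have hk := qnFact_q_ne_zero k
    have hl := qnFact_q_ne_zero l
    have hjk := qnFact_q_ne_zero (j + k)
    have hkl := qnFact_q_ne_zero (k + l)
    field_simp
  · rw [qBinom_of_lt q h, zero_mul]
    rcases le_or_gt j n with h' | h'
    · rw [qBinom_of_lt q (show n - j < j + k - j by omega), mul_zero]
    · rw [qBinom_of_lt q h', zero_mul]

theorem sum_range_alternating_qBinom (s m : ℕ) (hm : m ≤ s) :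
    ∑ j ∈ Finset.range (m + 1),
        (-1 : K) ^ j * q ^ ((s + 1 - j) * (s + 1 - j - 1) / 2) * qBinom q (s + 1) j =
      (-1) ^ m * q ^ ((s + 1 - m) * (s + 1 - m - 1) / 2) * qBinom q s m := by
  induction m with
  | zero => simp [qBinom_zero_right]
  | succ m ih =>
    rw [Finset.sum_range_succ, ih (by omega)]
    obtain ⟨d, rfl⟩ := Nat.exists_eq_add_of_le (show m ≤ s by omega)
    rw [qBinom_pascal, show m + d + 1 - m = d + 1 by omega,
      show m + d + 1 - (m + 1) = d by omega, Nat.triangle_succ]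
    ring

/-- The alternating sum `∑ j, (-1)^j q^{(s-j)(s-j-1)/2} binom_q(s,j)` vanishes for `s ≥ 1`. -/
theorem sum_alternating_qBinom_eq_zero {s : ℕ} (hs : 1 ≤ s) :
    ∑ j ∈ Finset.range (s + 1),
      (-1 : K) ^ j * q ^ ((s - j) * (s - j - 1) / 2) * qBinom q s j = 0 := by
  obtain ⟨s, rfl⟩ := Nat.exists_eq_add_of_le' hs
  rw [Finset.sum_range_succ, sum_range_alternating_qBinom s s le_rfl]
  simp [qBinom_self, pow_succ]

theorem statement9 (n s : ℕ) (hs : 1 ≤ s) :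
    q ^ (s * (s - 1) / 2) * qBinom q n s =
      ∑ j ∈ Finset.Icc 1 s,
        (-1 : K) ^ (j - 1) * q ^ ((s - j) * (s - j - 1) / 2) *
          qBinom q n j * qBinom q (n - j) (s - j) := by
  have h := sum_alternating_qBinom_eq_zero hs
  rw [Finset.range_eq_Ico, Finset.sum_eq_sum_Ico_succ_bot (by omega)] at h
  simp only [pow_zero, one_mul, Nat.sub_zero, qBinom_zero_right, mul_one, zero_add] at h
  rw [eq_neg_of_add_eq_zero_left h, ← Finset.sum_neg_distrib, Finset.sum_mul]
  refine Finset.sum_congr (by ext; simp) fun j hj => ?_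
  obtain ⟨hj1, hj2⟩ := Finset.mem_Ico.mp hj
  obtain ⟨i, rfl⟩ := Nat.exists_eq_add_of_le' hj1
  rw [mul_assoc _ (qBinom q n (i + 1)), qBinom_mul_qBinom_sub (by omega), Nat.add_sub_cancel]
  ring
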